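/- There is no tuple (c_1, …, c_8) ∈ 𝔽_7⁸ such that the polynomial f(x) = c_1x + c_2x² + ⋯ + c_8x⁸ + x⁹ ∈ 𝔽_7[x] is squarefree and the 4×4 matrix A with entries a_{ij} = κ_{7i−j}, where f(x)³ = Σ_m κ_m x^m, has rank 1. (Equivalently: no genus 4 hyperelliptic curve over 𝔽_7 with a defining polynomial of this form has a-number 3.) -/

import Mathlib

open Polynomial

set_option linter.unusedVariables false

namespace RankOneF7

/-- Check a Boolean predicate at all residues below seven. -/
def all7 (p : ℕ → Bool) : Bool :=
  p 0 && (p 1 && (p 2 && (p 3 && (p 4 && (p 5 && p 6)))))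

theorem all7_spec {p : ℕ → Bool} (h : all7 p = true) (n : ℕ) (hn : n < 7) : p n = true := by
  simp only [all7, Bool.and_eq_true] at h
  obtain ⟨h0, h1, h2, h3, h4, h5, h6⟩ := h
  interval_cases n <;> assumption

/-- Boolean implication, lazy in the conclusion. -/
def imp (a b : Bool) : Bool := !a || b

theorem imp_spec {a b : Bool} (h : imp a b = true) (ha : a = true) : b = true := by
  subst ha
  simpa [imp] using h

/-- Congruence modulo seven. -/
def eq7 (a b : ℕ) : Bool := Nat.beq (a % 7) (b % 7)

theorem eq7_iff {a b : ℕ} : eq7 a b = true ↔ (a : ZMod 7) = (b : ZMod 7) := by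
  rw [eq7, Nat.beq_eq, ZMod.natCast_eq_natCast_iff, Nat.ModEq]

/-! `kappa_m` is the coefficient of `x^m` in the cube of `c1 x + ... + c8 x^8 + x^9`. -/

def kappa3 (c1 c2 c3 c4 c5 c6 c7 c8 : ℕ) : ℕ :=
  c1 * c1 * c1

def kappa4 (c1 c2 c3 c4 c5 c6 c7 c8 : ℕ) : ℕ :=
  3 * c1 * c1 * c2

def kappa5 (c1 c2 c3 c4 c5 c6 c7 c8 : ℕ) : ℕ :=
  3 * c1 * c1 * c3 + 3 * c1 * c2 * c2

def kappa6 (c1 c2 c3 c4 c5 c6 c7 c8 : ℕ) : ℕ :=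
  3 * c1 * c1 * c4 + 6 * c1 * c2 * c3 + c2 * c2 * c2

def kappa7 (c1 c2 c3 c4 c5 c6 c7 c8 : ℕ) : ℕ :=
  3 * c1 * c1 * c5 + 6 * c1 * c2 * c4 + 3 * c1 * c3 * c3 + 3 * c2 * c2 * c3

def kappa8 (c1 c2 c3 c4 c5 c6 c7 c8 : ℕ) : ℕ :=
  3 * c1 * c1 * c6 + 6 * c1 * c2 * c5 + 6 * c1 * c3 * c4 + 3 * c2 * c2 * c4 + 3 * c2 * c3 * c3

def kappa9 (c1 c2 c3 c4 c5 c6 c7 c8 : ℕ) : ℕ :=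
  3 * c1 * c1 * c7 + 6 * c1 * c2 * c6 + 6 * c1 * c3 * c5 + 3 * c1 * c4 * c4 + 3 * c2 * c2 * c5 + 6 * c2 * c3 * c4 + c3 * c3 * c3

def kappa10 (c1 c2 c3 c4 c5 c6 c7 c8 : ℕ) : ℕ :=
  3 * c1 * c1 * c8 + 6 * c1 * c2 * c7 + 6 * c1 * c3 * c6 + 6 * c1 * c4 * c5 + 3 * c2 * c2 * c6 + 6 * c2 * c3 * c5 + 3 * c2 * c4 * c4 + 3 * c3 * c3 * c4

def kappa11 (c1 c2 c3 c4 c5 c6 c7 c8 : ℕ) : ℕ :=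
  3 * c1 * c1 + 6 * c1 * c2 * c8 + 6 * c1 * c3 * c7 + 6 * c1 * c4 * c6 + 3 * c1 * c5 * c5 + 3 * c2 * c2 * c7 + 6 * c2 * c3 * c6 + 6 * c2 * c4 * c5 + 3 * c3 * c3 * c5 + 3 * c3 * c4 * c4

def kappa12 (c1 c2 c3 c4 c5 c6 c7 c8 : ℕ) : ℕ :=
  6 * c1 * c2 + 6 * c1 * c3 * c8 + 6 * c1 * c4 * c7 + 6 * c1 * c5 * c6 + 3 * c2 * c2 * c8 + 6 * c2 * c3 * c7 + 6 * c2 * c4 * c6 + 3 * c2 * c5 * c5 + 3 * c3 * c3 * c6 + 6 * c3 * c4 * c5 + c4 * c4 * c4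

def kappa13 (c1 c2 c3 c4 c5 c6 c7 c8 : ℕ) : ℕ :=
  6 * c1 * c3 + 6 * c1 * c4 * c8 + 6 * c1 * c5 * c7 + 3 * c1 * c6 * c6 + 3 * c2 * c2 + 6 * c2 * c3 * c8 + 6 * c2 * c4 * c7 + 6 * c2 * c5 * c6 + 3 * c3 * c3 * c7 + 6 * c3 * c4 * c6 + 3 * c3 * c5 * c5 + 3 * c4 * c4 * c5

def kappa14 (c1 c2 c3 c4 c5 c6 c7 c8 : ℕ) : ℕ :=
  6 * c1 * c4 + 6 * c1 * c5 * c8 + 6 * c1 * c6 * c7 + 6 * c2 * c3 + 6 * c2 * c4 * c8 + 6 * c2 * c5 * c7 + 3 * c2 * c6 * c6 + 3 * c3 * c3 * c8 + 6 * c3 * c4 * c7 + 6 * c3 * c5 * c6 + 3 * c4 * c4 * c6 + 3 * c4 * c5 * c5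

def kappa15 (c1 c2 c3 c4 c5 c6 c7 c8 : ℕ) : ℕ :=
  6 * c1 * c5 + 6 * c1 * c6 * c8 + 3 * c1 * c7 * c7 + 6 * c2 * c4 + 6 * c2 * c5 * c8 + 6 * c2 * c6 * c7 + 3 * c3 * c3 + 6 * c3 * c4 * c8 + 6 * c3 * c5 * c7 + 3 * c3 * c6 * c6 + 3 * c4 * c4 * c7 + 6 * c4 * c5 * c6 + c5 * c5 * c5

def kappa16 (c1 c2 c3 c4 c5 c6 c7 c8 : ℕ) : ℕ :=
  6 * c1 * c6 + 6 * c1 * c7 * c8 + 6 * c2 * c5 + 6 * c2 * c6 * c8 + 3 * c2 * c7 * c7 + 6 * c3 * c4 + 6 * c3 * c5 * c8 + 6 * c3 * c6 * c7 + 3 * c4 * c4 * c8 + 6 * c4 * c5 * c7 + 3 * c4 * c6 * c6 + 3 * c5 * c5 * c6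

def kappa17 (c1 c2 c3 c4 c5 c6 c7 c8 : ℕ) : ℕ :=
  6 * c1 * c7 + 3 * c1 * c8 * c8 + 6 * c2 * c6 + 6 * c2 * c7 * c8 + 6 * c3 * c5 + 6 * c3 * c6 * c8 + 3 * c3 * c7 * c7 + 3 * c4 * c4 + 6 * c4 * c5 * c8 + 6 * c4 * c6 * c7 + 3 * c5 * c5 * c7 + 3 * c5 * c6 * c6

def kappa18 (c1 c2 c3 c4 c5 c6 c7 c8 : ℕ) : ℕ :=
  6 * c1 * c8 + 6 * c2 * c7 + 3 * c2 * c8 * c8 + 6 * c3 * c6 + 6 * c3 * c7 * c8 + 6 * c4 * c5 + 6 * c4 * c6 * c8 + 3 * c4 * c7 * c7 + 3 * c5 * c5 * c8 + 6 * c5 * c6 * c7 + c6 * c6 * c6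

def kappa19 (c1 c2 c3 c4 c5 c6 c7 c8 : ℕ) : ℕ :=
  3 * c1 + 6 * c2 * c8 + 6 * c3 * c7 + 3 * c3 * c8 * c8 + 6 * c4 * c6 + 6 * c4 * c7 * c8 + 3 * c5 * c5 + 6 * c5 * c6 * c8 + 3 * c5 * c7 * c7 + 3 * c6 * c6 * c7

def kappa20 (c1 c2 c3 c4 c5 c6 c7 c8 : ℕ) : ℕ :=
  3 * c2 + 6 * c3 * c8 + 6 * c4 * c7 + 3 * c4 * c8 * c8 + 6 * c5 * c6 + 6 * c5 * c7 * c8 + 3 * c6 * c6 * c8 + 3 * c6 * c7 * c7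

def kappa21 (c1 c2 c3 c4 c5 c6 c7 c8 : ℕ) : ℕ :=
  3 * c3 + 6 * c4 * c8 + 6 * c5 * c7 + 3 * c5 * c8 * c8 + 3 * c6 * c6 + 6 * c6 * c7 * c8 + c7 * c7 * c7

def kappa22 (c1 c2 c3 c4 c5 c6 c7 c8 : ℕ) : ℕ :=
  3 * c4 + 6 * c5 * c8 + 6 * c6 * c7 + 3 * c6 * c8 * c8 + 3 * c7 * c7 * c8

def kappa23 (c1 c2 c3 c4 c5 c6 c7 c8 : ℕ) : ℕ :=
  3 * c5 + 6 * c6 * c8 + 3 * c7 * c7 + 3 * c7 * c8 * c8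

def kappa24 (c1 c2 c3 c4 c5 c6 c7 c8 : ℕ) : ℕ :=
  3 * c6 + 6 * c7 * c8 + c8 * c8 * c8

def kappa25 (c1 c2 c3 c4 c5 c6 c7 c8 : ℕ) : ℕ :=
  3 * c7 + 3 * c8 * c8

def kappa26 (c1 c2 c3 c4 c5 c6 c7 c8 : ℕ) : ℕ :=
  3 * c8

def kappa27 (c1 c2 c3 c4 c5 c6 c7 c8 : ℕ) : ℕ :=
  1

/-- The polynomial with given coefficients. -/
noncomputable def poly (c1 c2 c3 c4 c5 c6 c7 c8 : ℕ) : (ZMod 7)[X] :=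
  C (c1 : ZMod 7) * X ^ 1 + C (c2 : ZMod 7) * X ^ 2 + C (c3 : ZMod 7) * X ^ 3 + C (c4 : ZMod 7) * X ^ 4 + C (c5 : ZMod 7) * X ^ 5 + C (c6 : ZMod 7) * X ^ 6 + C (c7 : ZMod 7) * X ^ 7 + C (c8 : ZMod 7) * X ^ 8 + X ^ 9

set_option maxHeartbeats 4000000 in
theorem poly_cube (c1 c2 c3 c4 c5 c6 c7 c8 : ℕ) :
    (poly c1 c2 c3 c4 c5 c6 c7 c8) ^ 3 =
      C ((kappa3 c1 c2 c3 c4 c5 c6 c7 c8 : ℕ) : ZMod 7) * X ^ 3 +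
      C ((kappa4 c1 c2 c3 c4 c5 c6 c7 c8 : ℕ) : ZMod 7) * X ^ 4 +
      C ((kappa5 c1 c2 c3 c4 c5 c6 c7 c8 : ℕ) : ZMod 7) * X ^ 5 +
      C ((kappa6 c1 c2 c3 c4 c5 c6 c7 c8 : ℕ) : ZMod 7) * X ^ 6 +
      C ((kappa7 c1 c2 c3 c4 c5 c6 c7 c8 : ℕ) : ZMod 7) * X ^ 7 +
      C ((kappa8 c1 c2 c3 c4 c5 c6 c7 c8 : ℕ) : ZMod 7) * X ^ 8 +
      C ((kappa9 c1 c2 c3 c4 c5 c6 c7 c8 : ℕ) : ZMod 7) * X ^ 9 +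
      C ((kappa10 c1 c2 c3 c4 c5 c6 c7 c8 : ℕ) : ZMod 7) * X ^ 10 +
      C ((kappa11 c1 c2 c3 c4 c5 c6 c7 c8 : ℕ) : ZMod 7) * X ^ 11 +
      C ((kappa12 c1 c2 c3 c4 c5 c6 c7 c8 : ℕ) : ZMod 7) * X ^ 12 +
      C ((kappa13 c1 c2 c3 c4 c5 c6 c7 c8 : ℕ) : ZMod 7) * X ^ 13 +
      C ((kappa14 c1 c2 c3 c4 c5 c6 c7 c8 : ℕ) : ZMod 7) * X ^ 14 +
      C ((kappa15 c1 c2 c3 c4 c5 c6 c7 c8 : ℕ) : ZMod 7) * X ^ 15 +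
      C ((kappa16 c1 c2 c3 c4 c5 c6 c7 c8 : ℕ) : ZMod 7) * X ^ 16 +
      C ((kappa17 c1 c2 c3 c4 c5 c6 c7 c8 : ℕ) : ZMod 7) * X ^ 17 +
      C ((kappa18 c1 c2 c3 c4 c5 c6 c7 c8 : ℕ) : ZMod 7) * X ^ 18 +
      C ((kappa19 c1 c2 c3 c4 c5 c6 c7 c8 : ℕ) : ZMod 7) * X ^ 19 +
      C ((kappa20 c1 c2 c3 c4 c5 c6 c7 c8 : ℕ) : ZMod 7) * X ^ 20 +
      C ((kappa21 c1 c2 c3 c4 c5 c6 c7 c8 : ℕ) : ZMod 7) * X ^ 21 +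
      C ((kappa22 c1 c2 c3 c4 c5 c6 c7 c8 : ℕ) : ZMod 7) * X ^ 22 +
      C ((kappa23 c1 c2 c3 c4 c5 c6 c7 c8 : ℕ) : ZMod 7) * X ^ 23 +
      C ((kappa24 c1 c2 c3 c4 c5 c6 c7 c8 : ℕ) : ZMod 7) * X ^ 24 +
      C ((kappa25 c1 c2 c3 c4 c5 c6 c7 c8 : ℕ) : ZMod 7) * X ^ 25 +
      C ((kappa26 c1 c2 c3 c4 c5 c6 c7 c8 : ℕ) : ZMod 7) * X ^ 26 +
      C ((kappa27 c1 c2 c3 c4 c5 c6 c7 c8 : ℕ) : ZMod 7) * X ^ 27 := by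
  simp only [poly, kappa3, kappa4, kappa5, kappa6, kappa7, kappa8, kappa9, kappa10, kappa11, kappa12, kappa13, kappa14, kappa15, kappa16, kappa17, kappa18, kappa19, kappa20, kappa21, kappa22, kappa23, kappa24, kappa25, kappa26, kappa27]
  push_cast
  simp only [map_add, map_mul, map_one, map_ofNat]
  ring

theorem coeff6 (c1 c2 c3 c4 c5 c6 c7 c8 : ℕ) :
    ((poly c1 c2 c3 c4 c5 c6 c7 c8) ^ 3).coeff 6 = ((kappa6 c1 c2 c3 c4 c5 c6 c7 c8 : ℕ) : ZMod 7) := by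
  rw [poly_cube]
  simp only [coeff_add, coeff_C_mul, coeff_X_pow]
  norm_num

theorem coeff5 (c1 c2 c3 c4 c5 c6 c7 c8 : ℕ) :
    ((poly c1 c2 c3 c4 c5 c6 c7 c8) ^ 3).coeff 5 = ((kappa5 c1 c2 c3 c4 c5 c6 c7 c8 : ℕ) : ZMod 7) := by
  rw [poly_cube]
  simp only [coeff_add, coeff_C_mul, coeff_X_pow]
  norm_num

theorem coeff4 (c1 c2 c3 c4 c5 c6 c7 c8 : ℕ) :
    ((poly c1 c2 c3 c4 c5 c6 c7 c8) ^ 3).coeff 4 = ((kappa4 c1 c2 c3 c4 c5 c6 c7 c8 : ℕ) : ZMod 7) := by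
  rw [poly_cube]
  simp only [coeff_add, coeff_C_mul, coeff_X_pow]
  norm_num

theorem coeff3 (c1 c2 c3 c4 c5 c6 c7 c8 : ℕ) :
    ((poly c1 c2 c3 c4 c5 c6 c7 c8) ^ 3).coeff 3 = ((kappa3 c1 c2 c3 c4 c5 c6 c7 c8 : ℕ) : ZMod 7) := by
  rw [poly_cube]
  simp only [coeff_add, coeff_C_mul, coeff_X_pow]
  norm_num

theorem coeff13 (c1 c2 c3 c4 c5 c6 c7 c8 : ℕ) :
    ((poly c1 c2 c3 c4 c5 c6 c7 c8) ^ 3).coeff 13 = ((kappa13 c1 c2 c3 c4 c5 c6 c7 c8 : ℕ) : ZMod 7) := by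
  rw [poly_cube]
  simp only [coeff_add, coeff_C_mul, coeff_X_pow]
  norm_num

theorem coeff12 (c1 c2 c3 c4 c5 c6 c7 c8 : ℕ) :
    ((poly c1 c2 c3 c4 c5 c6 c7 c8) ^ 3).coeff 12 = ((kappa12 c1 c2 c3 c4 c5 c6 c7 c8 : ℕ) : ZMod 7) := by
  rw [poly_cube]
  simp only [coeff_add, coeff_C_mul, coeff_X_pow]
  norm_num

theorem coeff11 (c1 c2 c3 c4 c5 c6 c7 c8 : ℕ) :
    ((poly c1 c2 c3 c4 c5 c6 c7 c8) ^ 3).coeff 11 = ((kappa11 c1 c2 c3 c4 c5 c6 c7 c8 : ℕ) : ZMod 7) := by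
  rw [poly_cube]
  simp only [coeff_add, coeff_C_mul, coeff_X_pow]
  norm_num

theorem coeff10 (c1 c2 c3 c4 c5 c6 c7 c8 : ℕ) :
    ((poly c1 c2 c3 c4 c5 c6 c7 c8) ^ 3).coeff 10 = ((kappa10 c1 c2 c3 c4 c5 c6 c7 c8 : ℕ) : ZMod 7) := by
  rw [poly_cube]
  simp only [coeff_add, coeff_C_mul, coeff_X_pow]
  norm_num

theorem coeff20 (c1 c2 c3 c4 c5 c6 c7 c8 : ℕ) :
    ((poly c1 c2 c3 c4 c5 c6 c7 c8) ^ 3).coeff 20 = ((kappa20 c1 c2 c3 c4 c5 c6 c7 c8 : ℕ) : ZMod 7) := by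
  rw [poly_cube]
  simp only [coeff_add, coeff_C_mul, coeff_X_pow]
  norm_num

theorem coeff19 (c1 c2 c3 c4 c5 c6 c7 c8 : ℕ) :
    ((poly c1 c2 c3 c4 c5 c6 c7 c8) ^ 3).coeff 19 = ((kappa19 c1 c2 c3 c4 c5 c6 c7 c8 : ℕ) : ZMod 7) := by
  rw [poly_cube]
  simp only [coeff_add, coeff_C_mul, coeff_X_pow]
  norm_num

theorem coeff18 (c1 c2 c3 c4 c5 c6 c7 c8 : ℕ) :
    ((poly c1 c2 c3 c4 c5 c6 c7 c8) ^ 3).coeff 18 = ((kappa18 c1 c2 c3 c4 c5 c6 c7 c8 : ℕ) : ZMod 7) := by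
  rw [poly_cube]
  simp only [coeff_add, coeff_C_mul, coeff_X_pow]
  norm_num

theorem coeff17 (c1 c2 c3 c4 c5 c6 c7 c8 : ℕ) :
    ((poly c1 c2 c3 c4 c5 c6 c7 c8) ^ 3).coeff 17 = ((kappa17 c1 c2 c3 c4 c5 c6 c7 c8 : ℕ) : ZMod 7) := by
  rw [poly_cube]
  simp only [coeff_add, coeff_C_mul, coeff_X_pow]
  norm_num

theorem coeff27 (c1 c2 c3 c4 c5 c6 c7 c8 : ℕ) :
    ((poly c1 c2 c3 c4 c5 c6 c7 c8) ^ 3).coeff 27 = ((kappa27 c1 c2 c3 c4 c5 c6 c7 c8 : ℕ) : ZMod 7) := by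
  rw [poly_cube]
  simp only [coeff_add, coeff_C_mul, coeff_X_pow]
  norm_num

theorem coeff26 (c1 c2 c3 c4 c5 c6 c7 c8 : ℕ) :
    ((poly c1 c2 c3 c4 c5 c6 c7 c8) ^ 3).coeff 26 = ((kappa26 c1 c2 c3 c4 c5 c6 c7 c8 : ℕ) : ZMod 7) := by
  rw [poly_cube]
  simp only [coeff_add, coeff_C_mul, coeff_X_pow]
  norm_num

theorem coeff25 (c1 c2 c3 c4 c5 c6 c7 c8 : ℕ) :
    ((poly c1 c2 c3 c4 c5 c6 c7 c8) ^ 3).coeff 25 = ((kappa25 c1 c2 c3 c4 c5 c6 c7 c8 : ℕ) : ZMod 7) := by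
  rw [poly_cube]
  simp only [coeff_add, coeff_C_mul, coeff_X_pow]
  norm_num

theorem coeff24 (c1 c2 c3 c4 c5 c6 c7 c8 : ℕ) :
    ((poly c1 c2 c3 c4 c5 c6 c7 c8) ^ 3).coeff 24 = ((kappa24 c1 c2 c3 c4 c5 c6 c7 c8 : ℕ) : ZMod 7) := by
  rw [poly_cube]
  simp only [coeff_add, coeff_C_mul, coeff_X_pow]
  norm_num

/-- The polynomial has a visible repeated factor: a double nonzero root or the shape `x q^4`. -/
def visible (c1 c2 c3 c4 c5 c6 c7 c8 : ℕ) : Bool :=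
  dbl 1 || dbl 2 || dbl 3 || dbl 4 || dbl 5 || dbl 6 || quad
where
  dbl (r : ℕ) : Bool :=
    eq7 (c1 * r ^ 1 + c2 * r ^ 2 + c3 * r ^ 3 + c4 * r ^ 4 + c5 * r ^ 5 + c6 * r ^ 6 + c7 * r ^ 7 + c8 * r ^ 8 + r ^ 9) 0 &&
    eq7 (c1 + 2 * c2 * r ^ 1 + 3 * c3 * r ^ 2 + 4 * c4 * r ^ 3 + 5 * c5 * r ^ 4 + 6 * c6 * r ^ 5 + 7 * c7 * r ^ 6 + 8 * c8 * r ^ 7 + 9 * r ^ 8) 0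
  quad : Bool := quadTest (2 * c8) (2 * c7 + 2 * (2 * c8) ^ 2)
  quadTest (u v : ℕ) : Bool :=
    eq7 c8 (4 * u) && (eq7 c7 (4 * v + 6 * u ^ 2) && (eq7 c6 (12 * u * v + 4 * u ^ 3) &&
    (eq7 c5 (6 * v ^ 2 + 12 * u ^ 2 * v + u ^ 4) && (eq7 c4 (12 * u * v ^ 2 + 4 * u ^ 3 * v) &&
    (eq7 c3 (4 * v ^ 3 + 6 * u ^ 2 * v ^ 2) && (eq7 c2 (4 * u * v ^ 3) && eq7 c1 (v ^ 4)))))))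

/-- The exhaustive search, pruned by the vanishing of the minors as soon as possible. -/
def search : Bool :=
  all7 fun c1 => imp (!eq7 c1 0) <|
  all7 fun c8 => all7 fun c7 => all7 fun c6 =>
  all7 fun c2 => imp (eq7 (3 * c1 * c1 * c2 * (3 * c6 + 6 * c7 * c8 + c8 * c8 * c8)) (c1 * c1 * c1 * (3 * c7 + 3 * c8 * c8))) <|
  all7 fun c3 => imp (eq7 ((3 * c1 * c1 * c3 + 3 * c1 * c2 * c2) * (3 * c6 + 6 * c7 * c8 + c8 * c8 * c8)) (c1 * c1 * c1 * (3 * c8))) <|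
  all7 fun c4 => imp (eq7 ((3 * c1 * c1 * c4 + 6 * c1 * c2 * c3 + c2 * c2 * c2) * (3 * c6 + 6 * c7 * c8 + c8 * c8 * c8)) (c1 * c1 * c1)) <|
  all7 fun c5 =>
    imp (eq7 (kappa12 c1 c2 c3 c4 c5 c6 c7 c8) ((kappa13 c1 c2 c3 c4 c5 c6 c7 c8) * (kappa26 c1 c2 c3 c4 c5 c6 c7 c8))) <|
    imp (eq7 (kappa11 c1 c2 c3 c4 c5 c6 c7 c8) ((kappa13 c1 c2 c3 c4 c5 c6 c7 c8) * (kappa25 c1 c2 c3 c4 c5 c6 c7 c8))) <|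
    imp (eq7 (kappa10 c1 c2 c3 c4 c5 c6 c7 c8) ((kappa13 c1 c2 c3 c4 c5 c6 c7 c8) * (kappa24 c1 c2 c3 c4 c5 c6 c7 c8))) <|
    imp (eq7 (kappa19 c1 c2 c3 c4 c5 c6 c7 c8) ((kappa20 c1 c2 c3 c4 c5 c6 c7 c8) * (kappa26 c1 c2 c3 c4 c5 c6 c7 c8))) <|
    imp (eq7 (kappa18 c1 c2 c3 c4 c5 c6 c7 c8) ((kappa20 c1 c2 c3 c4 c5 c6 c7 c8) * (kappa25 c1 c2 c3 c4 c5 c6 c7 c8))) <|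
    imp (eq7 (kappa17 c1 c2 c3 c4 c5 c6 c7 c8) ((kappa20 c1 c2 c3 c4 c5 c6 c7 c8) * (kappa24 c1 c2 c3 c4 c5 c6 c7 c8))) <|
    visible c1 c2 c3 c4 c5 c6 c7 c8

set_option maxRecDepth 100000 in
theorem search_true : search = true := by
  decide +kernel

theorem not_squarefree_of_visible (c1 c2 c3 c4 c5 c6 c7 c8 : ℕ) (h : visible c1 c2 c3 c4 c5 c6 c7 c8 = true) :
    ¬ Squarefree (poly c1 c2 c3 c4 c5 c6 c7 c8) := by
  have : Fact (Nat.Prime 7) := ⟨by norm_num⟩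
  have hq : visible.quad c1 c2 c3 c4 c5 c6 c7 c8 = true → ¬ Squarefree (poly c1 c2 c3 c4 c5 c6 c7 c8) := by
    intro h hs
    unfold visible.quad at h
    generalize 2 * c7 + 2 * (2 * c8) ^ 2 = v at h
    generalize 2 * c8 = u at h
    simp only [visible.quadTest, Bool.and_eq_true, eq7_iff] at h
    obtain ⟨h8, h7, h6, h5, h4, h3, h2, h1⟩ := h
    set q : (ZMod 7)[X] := X ^ 2 + C (u : ZMod 7) * X + C (v : ZMod 7) with hqdef
    have hf : poly c1 c2 c3 c4 c5 c6 c7 c8 = q * q * (X * q ^ 2) := by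
      simp only [poly, h1, h2, h3, h4, h5, h6, h7, h8, hqdef]
      push_cast
      simp only [map_add, map_mul, map_pow, map_ofNat]
      ring
    have hu : IsUnit q := hs q ⟨_, hf⟩
    have hd : q.natDegree = 2 := by
      rw [hqdef]
      compute_degree!
    rw [natDegree_eq_zero_of_isUnit hu] at hd
    omega
  have hr : ∀ r, visible.dbl c1 c2 c3 c4 c5 c6 c7 c8 r = true → ¬ Squarefree (poly c1 c2 c3 c4 c5 c6 c7 c8) := by
    intro r h hs
    simp only [visible.dbl, Bool.and_eq_true, eq7_iff] at h
    obtain ⟨h0, h1⟩ := h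
    push_cast at h0 h1
    have e0 : (poly c1 c2 c3 c4 c5 c6 c7 c8).eval (r : ZMod 7) = 0 := by
      simp only [poly, eval_add, eval_mul, eval_C, eval_pow, eval_X]
      exact h0
    have e1 : (derivative (poly c1 c2 c3 c4 c5 c6 c7 c8)).eval (r : ZMod 7) = 0 := by
      rw [← h1]
      simp [poly]
      ring
    obtain ⟨g, hg⟩ := dvd_iff_isRoot.mpr e0
    rw [hg] at e1
    simp at e1
    obtain ⟨k, hk⟩ := dvd_iff_isRoot.mpr e1
    have hu : IsUnit (X - C (r : ZMod 7)) := hs _ ⟨k, by rw [hg, hk]; ring⟩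
    exact not_isUnit_X_sub_C _ hu
  simp only [visible, Bool.or_eq_true] at h
  rcases h with (((((h | h) | h) | h) | h) | h) | h
  all_goals first | exact hr _ h | exact hq h

theorem minor_zero (A : Matrix (Fin 4) (Fin 4) (ZMod 7)) (h : A.rank = 1) (i k j l : Fin 4) :
    A i j * A k l = A i l * A k j := by
  have : Fact (Nat.Prime 7) := ⟨by norm_num⟩
  have h1 : ((A.submatrix ![i, k] ![j, l]).rank) ≤ 1 := h ▸ A.rank_submatrix_le _ _
  by_contra hne
  have hdet : IsUnit (A.submatrix ![i, k] ![j, l]) := by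
    rw [Matrix.isUnit_iff_isUnit_det, isUnit_iff_ne_zero, Matrix.det_fin_two]
    simpa [sub_eq_zero] using hne
  rw [Matrix.rank_of_isUnit _ hdet, Fintype.card_fin] at h1
  omega

end RankOneF7


/-- No tuple `(c_1, …, c_8) ∈ 𝔽_7⁸` makes `f = Σ c_i x^i + x^9` squarefree with
Cartier–Manin matrix of rank one (genus 4, `p = 7`). -/
theorem no_rank_one_genus4_over_F7 :
    ¬ ∃ (c : Fin 8 → ZMod 7) (f : (ZMod 7)[X]) (A : Matrix (Fin 4) (Fin 4) (ZMod 7)),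
      f = (∑ i : Fin 8, C (c i) * X ^ ((i : ℕ) + 1)) + X ^ 9 ∧
      (∀ i j : Fin 4,
        A i j = (f ^ 3).coeff (7 * ((i : ℕ) + 1) - ((j : ℕ) + 1))) ∧
      Squarefree f ∧ A.rank = 1 := by
  have : Fact (Nat.Prime 7) := ⟨by norm_num⟩
  rintro ⟨c, f, A, hf, hA, hs, hr⟩
  obtain ⟨c1, l1, e1⟩ : ∃ n : ℕ, n < 7 ∧ c 0 = (n : ZMod 7) :=
    ⟨(c 0).val, ZMod.val_lt _, (ZMod.natCast_zmod_val _).symm⟩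
  obtain ⟨c2, l2, e2⟩ : ∃ n : ℕ, n < 7 ∧ c 1 = (n : ZMod 7) :=
    ⟨(c 1).val, ZMod.val_lt _, (ZMod.natCast_zmod_val _).symm⟩
  obtain ⟨c3, l3, e3⟩ : ∃ n : ℕ, n < 7 ∧ c 2 = (n : ZMod 7) :=
    ⟨(c 2).val, ZMod.val_lt _, (ZMod.natCast_zmod_val _).symm⟩
  obtain ⟨c4, l4, e4⟩ : ∃ n : ℕ, n < 7 ∧ c 3 = (n : ZMod 7) :=
    ⟨(c 3).val, ZMod.val_lt _, (ZMod.natCast_zmod_val _).symm⟩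
  obtain ⟨c5, l5, e5⟩ : ∃ n : ℕ, n < 7 ∧ c 4 = (n : ZMod 7) :=
    ⟨(c 4).val, ZMod.val_lt _, (ZMod.natCast_zmod_val _).symm⟩
  obtain ⟨c6, l6, e6⟩ : ∃ n : ℕ, n < 7 ∧ c 5 = (n : ZMod 7) :=
    ⟨(c 5).val, ZMod.val_lt _, (ZMod.natCast_zmod_val _).symm⟩
  obtain ⟨c7, l7, e7⟩ : ∃ n : ℕ, n < 7 ∧ c 6 = (n : ZMod 7) :=
    ⟨(c 6).val, ZMod.val_lt _, (ZMod.natCast_zmod_val _).symm⟩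
  obtain ⟨c8, l8, e8⟩ : ∃ n : ℕ, n < 7 ∧ c 7 = (n : ZMod 7) :=
    ⟨(c 7).val, ZMod.val_lt _, (ZMod.natCast_zmod_val _).symm⟩
  replace hf : f = RankOneF7.poly c1 c2 c3 c4 c5 c6 c7 c8 := by
    rw [hf]
    simp only [Fin.sum_univ_eight, e1, e2, e3, e4, e5, e6, e7, e8, RankOneF7.poly]
    simp
  have hm := RankOneF7.minor_zero A hr
  have a00 : A 0 0 = ((RankOneF7.kappa6 c1 c2 c3 c4 c5 c6 c7 c8 : ℕ) : ZMod 7) := by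
    rw [hA, hf]
    exact RankOneF7.coeff6 c1 c2 c3 c4 c5 c6 c7 c8
  have a01 : A 0 1 = ((RankOneF7.kappa5 c1 c2 c3 c4 c5 c6 c7 c8 : ℕ) : ZMod 7) := by
    rw [hA, hf]
    exact RankOneF7.coeff5 c1 c2 c3 c4 c5 c6 c7 c8
  have a02 : A 0 2 = ((RankOneF7.kappa4 c1 c2 c3 c4 c5 c6 c7 c8 : ℕ) : ZMod 7) := by
    rw [hA, hf]
    exact RankOneF7.coeff4 c1 c2 c3 c4 c5 c6 c7 c8
  have a03 : A 0 3 = ((RankOneF7.kappa3 c1 c2 c3 c4 c5 c6 c7 c8 : ℕ) : ZMod 7) := by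
    rw [hA, hf]
    exact RankOneF7.coeff3 c1 c2 c3 c4 c5 c6 c7 c8
  have a10 : A 1 0 = ((RankOneF7.kappa13 c1 c2 c3 c4 c5 c6 c7 c8 : ℕ) : ZMod 7) := by
    rw [hA, hf]
    exact RankOneF7.coeff13 c1 c2 c3 c4 c5 c6 c7 c8
  have a11 : A 1 1 = ((RankOneF7.kappa12 c1 c2 c3 c4 c5 c6 c7 c8 : ℕ) : ZMod 7) := by
    rw [hA, hf]
    exact RankOneF7.coeff12 c1 c2 c3 c4 c5 c6 c7 c8
  have a12 : A 1 2 = ((RankOneF7.kappa11 c1 c2 c3 c4 c5 c6 c7 c8 : ℕ) : ZMod 7) := by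
    rw [hA, hf]
    exact RankOneF7.coeff11 c1 c2 c3 c4 c5 c6 c7 c8
  have a13 : A 1 3 = ((RankOneF7.kappa10 c1 c2 c3 c4 c5 c6 c7 c8 : ℕ) : ZMod 7) := by
    rw [hA, hf]
    exact RankOneF7.coeff10 c1 c2 c3 c4 c5 c6 c7 c8
  have a20 : A 2 0 = ((RankOneF7.kappa20 c1 c2 c3 c4 c5 c6 c7 c8 : ℕ) : ZMod 7) := by
    rw [hA, hf]
    exact RankOneF7.coeff20 c1 c2 c3 c4 c5 c6 c7 c8
  have a21 : A 2 1 = ((RankOneF7.kappa19 c1 c2 c3 c4 c5 c6 c7 c8 : ℕ) : ZMod 7) := by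
    rw [hA, hf]
    exact RankOneF7.coeff19 c1 c2 c3 c4 c5 c6 c7 c8
  have a22 : A 2 2 = ((RankOneF7.kappa18 c1 c2 c3 c4 c5 c6 c7 c8 : ℕ) : ZMod 7) := by
    rw [hA, hf]
    exact RankOneF7.coeff18 c1 c2 c3 c4 c5 c6 c7 c8
  have a23 : A 2 3 = ((RankOneF7.kappa17 c1 c2 c3 c4 c5 c6 c7 c8 : ℕ) : ZMod 7) := by
    rw [hA, hf]
    exact RankOneF7.coeff17 c1 c2 c3 c4 c5 c6 c7 c8
  have a30 : A 3 0 = ((RankOneF7.kappa27 c1 c2 c3 c4 c5 c6 c7 c8 : ℕ) : ZMod 7) := by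
    rw [hA, hf]
    exact RankOneF7.coeff27 c1 c2 c3 c4 c5 c6 c7 c8
  have a31 : A 3 1 = ((RankOneF7.kappa26 c1 c2 c3 c4 c5 c6 c7 c8 : ℕ) : ZMod 7) := by
    rw [hA, hf]
    exact RankOneF7.coeff26 c1 c2 c3 c4 c5 c6 c7 c8
  have a32 : A 3 2 = ((RankOneF7.kappa25 c1 c2 c3 c4 c5 c6 c7 c8 : ℕ) : ZMod 7) := by
    rw [hA, hf]
    exact RankOneF7.coeff25 c1 c2 c3 c4 c5 c6 c7 c8
  have a33 : A 3 3 = ((RankOneF7.kappa24 c1 c2 c3 c4 c5 c6 c7 c8 : ℕ) : ZMod 7) := by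
    rw [hA, hf]
    exact RankOneF7.coeff24 c1 c2 c3 c4 c5 c6 c7 c8
  have hc1 : (!RankOneF7.eq7 c1 0) = true := by
    rw [Bool.not_eq_true']
    by_contra hne
    rw [Bool.not_eq_false, RankOneF7.eq7_iff] at hne
    have hu : IsUnit (X : (ZMod 7)[X]) := by
      apply hs
      refine ⟨C (c2 : ZMod 7) * X ^ 0 + C (c3 : ZMod 7) * X ^ 1 + C (c4 : ZMod 7) * X ^ 2 + C (c5 : ZMod 7) * X ^ 3 + C (c6 : ZMod 7) * X ^ 4 + C (c7 : ZMod 7) * X ^ 5 + C (c8 : ZMod 7) * X ^ 6 + X ^ 7, ?_⟩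
      rw [hf]
      simp only [RankOneF7.poly, hne]
      push_cast
      simp only [map_zero]
      ring
    exact not_isUnit_X hu
  have k27 : RankOneF7.kappa27 c1 c2 c3 c4 c5 c6 c7 c8 = 1 := rfl
  have m2 := hm 0 3 2 3
  have m3 := hm 0 3 1 3
  have m4 := hm 0 3 0 3
  have n1 := hm 1 3 0 1
  have n2 := hm 1 3 0 2
  have n3 := hm 1 3 0 3
  have n4 := hm 2 3 0 1
  have n5 := hm 2 3 0 2
  have n6 := hm 2 3 0 3
  simp only [a00, a01, a02, a03, a10, a11, a12, a13, a20, a21, a22, a23, a30, a31, a32, a33, k27, Nat.cast_one, mul_one] at m2 m3 m4 n1 n2 n3 n4 n5 n6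
  have S := RankOneF7.search_true
  unfold RankOneF7.search at S
  have S := RankOneF7.all7_spec S c1 l1
  have S := RankOneF7.imp_spec S hc1
  have S := RankOneF7.all7_spec S c8 l8
  have S := RankOneF7.all7_spec S c7 l7
  have S := RankOneF7.all7_spec S c6 l6
  have S := RankOneF7.all7_spec S c2 l2
  have S := RankOneF7.imp_spec S (by
    rw [RankOneF7.eq7_iff]
    simp only [RankOneF7.kappa3, RankOneF7.kappa4, RankOneF7.kappa24, RankOneF7.kappa25] at m2
    push_cast at m2 ⊢
    linear_combination m2)
  have S := RankOneF7.all7_spec S c3 l3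
  have S := RankOneF7.imp_spec S (by
    rw [RankOneF7.eq7_iff]
    simp only [RankOneF7.kappa3, RankOneF7.kappa5, RankOneF7.kappa24, RankOneF7.kappa26] at m3
    push_cast at m3 ⊢
    linear_combination m3)
  have S := RankOneF7.all7_spec S c4 l4
  have S := RankOneF7.imp_spec S (by
    rw [RankOneF7.eq7_iff]
    simp only [RankOneF7.kappa3, RankOneF7.kappa6, RankOneF7.kappa24] at m4
    push_cast at m4 ⊢
    linear_combination m4)
  have S := RankOneF7.all7_spec S c5 l5
  have S := RankOneF7.imp_spec S (by
    rw [RankOneF7.eq7_iff, Nat.cast_mul]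
    exact n1.symm)
  have S := RankOneF7.imp_spec S (by
    rw [RankOneF7.eq7_iff, Nat.cast_mul]
    exact n2.symm)
  have S := RankOneF7.imp_spec S (by
    rw [RankOneF7.eq7_iff, Nat.cast_mul]
    exact n3.symm)
  have S := RankOneF7.imp_spec S (by
    rw [RankOneF7.eq7_iff, Nat.cast_mul]
    exact n4.symm)
  have S := RankOneF7.imp_spec S (by
    rw [RankOneF7.eq7_iff, Nat.cast_mul]
    exact n5.symm)
  have S := RankOneF7.imp_spec S (by
    rw [RankOneF7.eq7_iff, Nat.cast_mul]
    exact n6.symm)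
  exact RankOneF7.not_squarefree_of_visible _ _ _ _ _ _ _ _ S (hf ▸ hs)
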